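/- Let M be a finitely generated 𝓡-module with pd_𝓡(M) ≤ 1 such that N = E¹(M) = Ext¹_𝓡(M, 𝓡) is pseudo-null and such that M has generic rank one over 𝓡 (i.e., M ⊗_𝓡 Q(𝓡) is a free Q(𝓡)-module of rank one). Then for any finite presentation 𝓡^m → 𝓡^n → N → 0, with the first map given by a matrix A ∈ M_{n×m}(𝓡), letting I ⊆ 𝓡 be the ideal generated by all n×n minors of A (the 0-th Fitting ideal Fitt_𝓡(N)), there is an isomorphism of 𝓡-modules 𝓡/I ≅ E²(N) = Ext²_𝓡(N, 𝓡). -/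

import Mathlib

noncomputable section

/-- The duality hypothesis: `Hom_Λ(𝓡, Λ) ≅ 𝓡` as `𝓡`-modules, where the `𝓡`-module
structure on `Hom_Λ(𝓡, Λ)` is `(r • φ)(x) = φ (r * x)`. -/
def SelfDualAlgebra (Λ 𝓡 : Type) [CommRing Λ] [CommRing 𝓡] [Algebra Λ 𝓡] : Prop :=
  ∃ e : (𝓡 →ₗ[Λ] Λ) ≃ₗ[Λ] 𝓡,
    ∀ (r : 𝓡) (φ : 𝓡 →ₗ[Λ] Λ),
      e (φ.comp (LinearMap.mulLeft Λ r)) = r * e φ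

/-- `Λ` is a regular local ring: its maximal ideal is generated by `dim Λ` elements. -/
def IsRegularLocal (Λ : Type) [CommRing Λ] [IsLocalRing Λ] : Prop :=
  ∃ s : Finset Λ, Ideal.span (s : Set Λ) = IsLocalRing.maximalIdeal Λ ∧
    (s.card : WithBot (WithTop ℕ)) = ringKrullDim Λ

/-- A prime ideal `q` has height at most one: there is no chain of primes
`q₀ < q₁ < q`. -/
def HeightLEOne (Λ : Type) [CommRing Λ] (q : Ideal Λ) : Prop :=
  ¬ ∃ q₀ q₁ : Ideal Λ, q₀.IsPrime ∧ q₁.IsPrime ∧ q₀ < q₁ ∧ q₁ < q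

/-- An `𝓡`-module `N` is pseudo-null over `Λ`: for every prime `q` of `Λ` of height at
most one, the localization `N_q` vanishes, i.e. every element of `N` is annihilated by
some `s ∉ q`. -/
def IsPseudoNull (Λ : Type) [CommRing Λ] {𝓡 : Type} [CommRing 𝓡] [Algebra Λ 𝓡]
    (N : Type) [AddCommGroup N] [Module 𝓡 N] : Prop :=
  ∀ q : Ideal Λ, q.IsPrime → HeightLEOne Λ q →
    ∀ x : N, ∃ s : Λ, s ∉ q ∧ algebraMap Λ 𝓡 s • x = 0

/-- A finitely generated module has projective dimension at most one: some (equivalently,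
any) surjection from a finite free module has projective kernel. -/
def ProjDimLEOne (𝓡 : Type) [CommRing 𝓡] (M : Type) [AddCommGroup M] [Module 𝓡 M] :
    Prop :=
  ∃ (n : ℕ) (φ : (Fin n → 𝓡) →ₗ[𝓡] M),
    Function.Surjective φ ∧ Module.Projective 𝓡 (LinearMap.ker φ)

abbrev ExtGrp (R : Type) [CommRing R] (M : Type) [AddCommGroup M] [Module R M] (i : ℕ) :
    ModuleCat R :=
  ((_root_.Ext R (ModuleCat R) i).obj (Opposite.op (ModuleCat.of R M))).obj (ModuleCat.of R R)

/-- `M` has generic rank one over `𝓡`: `M ⊗_𝓡 Q(𝓡)` is a free module of rank one over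
the total ring of fractions `Q(𝓡)`. -/
def GenericRankOne (𝓡 : Type) [CommRing 𝓡] (M : Type) [AddCommGroup M] [Module 𝓡 M] :
    Prop :=
  Nonempty (LocalizedModule (nonZeroDivisors 𝓡) M ≃ₗ[Localization (nonZeroDivisors 𝓡)]
    Localization (nonZeroDivisors 𝓡))

section Ext

open CategoryTheory

namespace ThreeTerm

variable {R : Type} [CommRing R] {F₀ F₁ F₂ X : Type}
  [AddCommGroup F₀] [Module R F₀] [AddCommGroup F₁] [Module R F₁]
  [AddCommGroup F₂] [Module R F₂] [AddCommGroup X] [Module R X]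

variable (R F₀ F₁ F₂) in
/-- The terms of the chain complex `0 → F₂ → F₁ → F₀`. -/
def obj : ℕ → ModuleCat.{0} R
  | 0 => ModuleCat.of R F₀
  | 1 => ModuleCat.of R F₁
  | 2 => ModuleCat.of R F₂
  | _ + 3 => ModuleCat.of R PUnit

/-- The differentials of the chain complex `0 → F₂ → F₁ → F₀`. -/
def diff (d₂ : F₂ →ₗ[R] F₁) (d₁ : F₁ →ₗ[R] F₀) :
    ∀ n : ℕ, obj R F₀ F₁ F₂ (n + 1) ⟶ obj R F₀ F₁ F₂ n
  | 0 => ModuleCat.ofHom d₁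
  | 1 => ModuleCat.ofHom d₂
  | _ + 2 => 0

/-- The chain complex `0 → F₂ → F₁ → F₀`. -/
def complex (d₂ : F₂ →ₗ[R] F₁) (d₁ : F₁ →ₗ[R] F₀) (h : d₁ ∘ₗ d₂ = 0) :
    ChainComplex (ModuleCat.{0} R) ℕ :=
  ChainComplex.of (obj R F₀ F₁ F₂) (diff d₂ d₁) fun n => by
    match n with
    | 0 => exact ModuleCat.hom_ext h
    | n + 1 => exact Limits.zero_comp

lemma complex_d (d₂ : F₂ →ₗ[R] F₁) (d₁ : F₁ →ₗ[R] F₀) (h : d₁ ∘ₗ d₂ = 0) (n : ℕ) :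
    (complex d₂ d₁ h).d (n + 1) n = diff d₂ d₁ n :=
  ChainComplex.of_d _ _ _

/-- An exact sequence `0 → F₂ → F₁ → F₀ → X → 0` with projective `Fᵢ`, as a projective
resolution of `X`. -/
def resolution [Module.Projective R F₀] [Module.Projective R F₁] [Module.Projective R F₂]
    (d₂ : F₂ →ₗ[R] F₁) (d₁ : F₁ →ₗ[R] F₀) (ε : F₀ →ₗ[R] X)
    (h₂ : Function.Injective d₂) (h₂₁ : Function.Exact d₂ d₁) (h₁₀ : Function.Exact d₁ ε)
    (h₀ : Function.Surjective ε) : ProjectiveResolution (ModuleCat.of R X) where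
  complex := complex d₂ d₁ h₂₁.linearMap_comp_eq_zero
  projective n := by
    match n with
    | 0 => exact (IsProjective.iff_projective F₀).1 inferInstance
    | 1 => exact (IsProjective.iff_projective F₁).1 inferInstance
    | 2 => exact (IsProjective.iff_projective F₂).1 inferInstance
    | n + 3 => exact (IsProjective.iff_projective (R := R) PUnit).1 inferInstance
  π := (ChainComplex.toSingle₀Equiv _ _).symm ⟨ModuleCat.ofHom ε, by
    rw [complex_d]
    exact ModuleCat.hom_ext h₁₀.linearMap_comp_eq_zero⟩
  quasiIso := ⟨fun n => by
    cases n with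
    | zero =>
      rw [ChainComplex.quasiIsoAt₀_iff, ShortComplex.quasiIso_iff_of_zeros']
      · refine (ShortComplex.exact_and_epi_g_iff_of_iso (S₂ := ShortComplex.mk
          (ModuleCat.ofHom d₁) (ModuleCat.ofHom ε)
          (ModuleCat.hom_ext h₁₀.linearMap_comp_eq_zero)) ?_).2 ⟨?_, ?_⟩
        · refine ShortComplex.isoMk (Iso.refl _) (Iso.refl _) (Iso.refl _) ?_ ?_
          · refine (Category.id_comp _).trans ((Category.comp_id _).trans ?_).symm
            exact complex_d d₂ d₁ h₂₁.linearMap_comp_eq_zero 0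
          · refine (Category.id_comp _).trans ((Category.comp_id _).trans ?_).symm
            exact ChainComplex.toSingle₀Equiv_symm_apply_f_zero _ _
        · exact (ShortComplex.ShortExact.moduleCat_exact_iff_function_exact _).2 h₁₀
        · exact (ModuleCat.epi_iff_surjective _).2 h₀
      all_goals rfl
    | succ n =>
      rw [quasiIsoAt_iff_exactAt']
      · rw [HomologicalComplex.exactAt_iff' _ (n + 1 + 1) (n + 1) n (by simp) (by simp),
          ShortComplex.moduleCat_exact_iff]
        intro x hx
        obtain ⟨y, hy⟩ : ∃ y, diff d₂ d₁ (n + 1) y = x := by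
          have hx' : diff d₂ d₁ n x = 0 := by
            rw [← complex_d d₂ d₁ h₂₁.linearMap_comp_eq_zero n]
            exact hx
          match n with
          | 0 => exact (h₂₁ x).1 hx'
          | 1 => exact ⟨0, (h₂ (hx'.trans (map_zero d₂).symm)).symm⟩
          | n + 2 => exact ⟨0, Subsingleton.elim (α := PUnit) _ _⟩
        rw [← complex_d d₂ d₁ h₂₁.linearMap_comp_eq_zero (n + 1)] at hy
        exact ⟨y, hy⟩
      · apply ChainComplex.exactAt_succ_single_obj⟩

end ThreeTerm

/-- If the differential leaving degree `n + 1` vanishes, the homology in degree `n + 1` is the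
cokernel of the differential arriving there. -/
lemma CochainComplex.exists_surjective_homology {R : Type} [CommRing R]
    (K : CochainComplex (ModuleCat.{0} R) ℕ) (n : ℕ) (h : K.d (n + 1) (n + 2) = 0) :
    ∃ q : K.X (n + 1) →ₗ[R] K.homology (n + 1), Function.Surjective q ∧
      LinearMap.ker q = LinearMap.range (K.d n (n + 1)).hom := by
  have := K.isIso_homologyι (n + 1) (n + 2) (by simp) h
  refine ⟨(K.pOpcycles (n + 1) ≫ inv (K.homologyι (n + 1))).hom,
    (ModuleCat.epi_iff_surjective _).1 inferInstance, ?_⟩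
  have hex : (ShortComplex.mk (K.d n (n + 1)) (K.pOpcycles (n + 1)) (by simp)).Exact :=
    ShortComplex.exact_of_g_is_cokernel _ (K.opcyclesIsCokernel n (n + 1) (by simp))
  have hinj : Function.Injective (inv (K.homologyι (n + 1))).hom :=
    (ModuleCat.mono_iff_injective _).1 inferInstance
  rw [ModuleCat.hom_comp, LinearMap.ker_comp_of_ker_eq_bot _ (LinearMap.ker_eq_bot.2 hinj)]
  exact hex.moduleCat_range_eq_ker.symm

/-- If a projective resolution `P` vanishes in degree `n + 2`, then `Ext (n + 1)` is the cokernel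
of the map dual to `P.complex.d (n + 1) n`. -/
lemma CategoryTheory.ProjectiveResolution.exists_surjective_ext {R : Type} [CommRing R]
    {X : ModuleCat.{0} R} (P : ProjectiveResolution X) (Y : ModuleCat.{0} R) (n : ℕ)
    (h : P.complex.d (n + 2) (n + 1) = 0) :
    ∃ q : (P.complex.X (n + 1) →ₗ[R] Y) →ₗ[R] ((_root_.Ext R (ModuleCat R) (n + 1)).obj
      (Opposite.op X)).obj Y, Function.Surjective q ∧
      LinearMap.ker q = LinearMap.range ((P.complex.d (n + 1) n).hom.lcomp R Y) := by
  obtain ⟨q, hq, hker⟩ := (P.complex.linearYonedaObj R Y).exists_surjective_homology n (by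
      rw [ChainComplex.linearYonedaObj_d, h]
      refine ModuleCat.hom_ext (LinearMap.ext fun x => ?_)
      exact Limits.zero_comp (C := ModuleCat R))
  let q' : (P.complex.X (n + 1) ⟶ Y) →ₗ[R] (P.complex.linearYonedaObj R Y).homology (n + 1) := q
  let e := (P.isoExt (R := R) (n + 1) Y).symm.toLinearEquiv
  let e' : (P.complex.X (n + 1) →ₗ[R] Y) →ₗ[R] (P.complex.X (n + 1) ⟶ Y) :=
    (ModuleCat.homLinearEquiv (S := R)).symm.toLinearMap
  refine ⟨e.toLinearMap ∘ₗ q' ∘ₗ e', e.surjective.comp (hq.comp fun f => ⟨f.hom, rfl⟩), ?_⟩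
  ext f
  refine (e.map_eq_zero_iff (x := q' (e' f))).trans ?_
  refine (LinearMap.mem_ker (f := q)).symm.trans ?_
  rw [hker]
  exact ⟨fun ⟨g, hg⟩ => ⟨ModuleCat.Hom.hom (show P.complex.X n ⟶ Y from g),
    congrArg (fun k : P.complex.X (n + 1) ⟶ Y => k.hom) hg⟩,
    fun ⟨g, hg⟩ => ⟨ModuleCat.ofHom g, congrArg ModuleCat.ofHom hg⟩⟩

open ThreeTerm in
/-- `Ext²(X, R)` is the cokernel of the dual of `d₂` if `0 → F₂ → F₁ → F₀ → X → 0` is a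
projective resolution. -/
theorem exists_surjective_ext_two {R : Type} [CommRing R] {F₀ F₁ F₂ X : Type}
    [AddCommGroup F₀] [Module R F₀] [AddCommGroup F₁] [Module R F₁]
    [AddCommGroup F₂] [Module R F₂] [AddCommGroup X] [Module R X]
    [Module.Projective R F₀] [Module.Projective R F₁] [Module.Projective R F₂]
    (d₂ : F₂ →ₗ[R] F₁) (d₁ : F₁ →ₗ[R] F₀) (ε : F₀ →ₗ[R] X)
    (h₂ : Function.Injective d₂) (h₂₁ : Function.Exact d₂ d₁) (h₁₀ : Function.Exact d₁ ε)
    (h₀ : Function.Surjective ε) :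
    ∃ q : (F₂ →ₗ[R] R) →ₗ[R] ((_root_.Ext R (ModuleCat R) 2).obj
      (Opposite.op (ModuleCat.of R X))).obj (ModuleCat.of R R), Function.Surjective q ∧
      LinearMap.ker q = LinearMap.range (d₂.lcomp R R) := by
  obtain ⟨q, hq, hker⟩ := (resolution d₂ d₁ ε h₂ h₂₁ h₁₀ h₀).exists_surjective_ext
    (ModuleCat.of R R) 1 (complex_d d₂ d₁ h₂₁.linearMap_comp_eq_zero 2)
  refine ⟨q, hq, hker.trans ?_⟩
  exact congrArg (fun d => LinearMap.range ((ModuleCat.Hom.hom d).lcomp R R))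
    (complex_d d₂ d₁ h₂₁.linearMap_comp_eq_zero 1)

open ThreeTerm in
/-- `Ext¹(X, R)` is the cokernel of the dual of `d₁` if `0 → F₁ → F₀ → X → 0` is a
projective resolution. -/
theorem exists_surjective_ext_one {R : Type} [CommRing R] {F₀ F₁ X : Type}
    [AddCommGroup F₀] [Module R F₀] [AddCommGroup F₁] [Module R F₁]
    [AddCommGroup X] [Module R X]
    [Module.Projective R F₀] [Module.Projective R F₁]
    (d₁ : F₁ →ₗ[R] F₀) (ε : F₀ →ₗ[R] X)
    (h₁ : Function.Injective d₁) (h₁₀ : Function.Exact d₁ ε)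
    (h₀ : Function.Surjective ε) :
    ∃ q : (F₁ →ₗ[R] R) →ₗ[R] ((_root_.Ext R (ModuleCat R) 1).obj
      (Opposite.op (ModuleCat.of R X))).obj (ModuleCat.of R R), Function.Surjective q ∧
      LinearMap.ker q = LinearMap.range (d₁.lcomp R R) := by
  have hinj : Function.Injective (0 : PUnit →ₗ[R] F₁) := Function.injective_of_subsingleton _
  have hex : Function.Exact (0 : PUnit →ₗ[R] F₁) d₁ := fun y =>
    ⟨fun h => ⟨0, (h₁ (h.trans (map_zero d₁).symm)).symm⟩, by rintro ⟨x, rfl⟩; simp⟩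
  obtain ⟨q, hq, hker⟩ := (resolution (0 : PUnit →ₗ[R] F₁) d₁ ε hinj hex h₁₀
    h₀).exists_surjective_ext (ModuleCat.of R R) 0 (complex_d 0 d₁ hex.linearMap_comp_eq_zero 1)
  refine ⟨q, hq, hker.trans ?_⟩
  exact congrArg (fun d => LinearMap.range ((ModuleCat.Hom.hom d).lcomp R R))
    (complex_d 0 d₁ hex.linearMap_comp_eq_zero 0)

end Ext

namespace IsLocalRing

/-- A local ring of height at least `d` whose maximal ideal has `d` generators. -/
structure HasRegularParameters (Λ : Type) [CommRing Λ] [IsLocalRing Λ] (d : ℕ) : Prop where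
  exists_generators : ∃ s : Fin d → Λ, Ideal.span (Set.range s) = maximalIdeal Λ
  le_height : (d : ℕ∞) ≤ (maximalIdeal Λ).height

variable {Λ : Type} [CommRing Λ] [IsLocalRing Λ] {d : ℕ}

lemma nontrivial_quotient_span_singleton {x : Λ} (hx : x ∈ maximalIdeal Λ) :
    Nontrivial (Λ ⧸ Ideal.span {x}) := by
  refine Ideal.Quotient.nontrivial_iff.2 fun h => ?_
  exact (maximalIdeal.isMaximal Λ).ne_top <| top_le_iff.1 (h ▸
    (Ideal.span_singleton_le_iff_mem _).2 hx)

lemma isLocalRing_quotient_span_singleton {x : Λ} (hx : x ∈ maximalIdeal Λ) :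
    IsLocalRing (Λ ⧸ Ideal.span {x}) :=
  have := nontrivial_quotient_span_singleton hx
  .of_surjective' (Ideal.Quotient.mk _) Ideal.Quotient.mk_surjective

lemma map_mk_maximalIdeal {x : Λ} [IsLocalRing (Λ ⧸ Ideal.span {x})] :
    (maximalIdeal Λ).map (Ideal.Quotient.mk (Ideal.span {x})) = maximalIdeal _ := by
  have hs := Ideal.Quotient.mk_surjective (I := Ideal.span {x})
  have h := ((local_hom_TFAE (Ideal.Quotient.mk (Ideal.span {x}))).out 0 4).1
    (hs.isLocalHom _)
  rw [← h, Ideal.map_comap_of_surjective _ hs]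

lemma HasRegularParameters.maximalIdeal_notMem_minimalPrimes
    (h : HasRegularParameters Λ (d + 1)) : maximalIdeal Λ ∉ minimalPrimes Λ := by
  intro hm
  have := h.le_height
  rw [Ideal.height_eq_zero_iff.2 hm] at this
  simp at this

variable [IsNoetherianRing Λ]

lemma HasRegularParameters.quotient (h : HasRegularParameters Λ (d + 1)) {x : Λ}
    (hx : x ∈ maximalIdeal Λ) (hx2 : x ∉ maximalIdeal Λ ^ 2)
    [IsLocalRing (Λ ⧸ Ideal.span {x})] : HasRegularParameters (Λ ⧸ Ideal.span {x}) d := by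
  obtain ⟨⟨s, hs⟩, hh⟩ := h
  refine ⟨?_, ?_⟩
  · obtain ⟨c, rfl⟩ := Ideal.mem_span_range_iff_exists_fun.1 (hs.symm ▸ hx)
    set x := ∑ i, c i * s i with hxdef
    have hsm (i) : s i ∈ maximalIdeal Λ := hs ▸ Ideal.subset_span ⟨i, rfl⟩
    obtain ⟨i, hi⟩ : ∃ i, IsUnit (c i) := by
      by_contra! hc
      refine hx2 (sum_mem fun i _ => ?_)
      rw [pow_two]
      exact Ideal.mul_mem_mul ((mem_maximalIdeal _).2 (hc i)) (hsm i)
    refine ⟨fun j => Ideal.Quotient.mk _ (s (i.succAbove j)), ?_⟩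
    rw [← map_mk_maximalIdeal]
    refine le_antisymm (Ideal.span_le.2 ?_) ?_
    · rintro _ ⟨j, rfl⟩
      exact Ideal.mem_map_of_mem _ (hsm _)
    · rw [← hs, Ideal.map_span, Ideal.span_le]
      rintro _ ⟨_, ⟨k, rfl⟩, rfl⟩
      rcases Fin.eq_self_or_eq_succAbove i k with rfl | ⟨j, rfl⟩
      · have hk : c k * s k = x - ∑ j, c (k.succAbove j) * s (k.succAbove j) := by
          rw [hxdef, Fin.sum_univ_succAbove _ k]; ring
        rw [SetLike.mem_coe, ← Ideal.unit_mul_mem_iff_mem _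
          (hi.map (Ideal.Quotient.mk (Ideal.span {x}))), ← map_mul, hk, map_sub, Ideal.Quotient.mk_singleton_self, zero_sub, map_sum]
        refine neg_mem (sum_mem fun j _ => ?_)
        rw [map_mul]
        exact Ideal.mul_mem_left _ _ (Ideal.subset_span ⟨j, rfl⟩)
      · exact Ideal.subset_span ⟨j, rfl⟩
  · have := Ideal.height_le_height_add_one_of_mem hx
    rw [map_mk_maximalIdeal] at this
    have h' := hh.trans this
    push_cast at h'
    exact (ENat.add_le_add_iff_right ENat.one_ne_top).1 h'

lemma HasRegularParameters.not_maximalIdeal_le_sq (h : HasRegularParameters Λ (d + 1)) :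
    ¬ maximalIdeal Λ ≤ maximalIdeal Λ ^ 2 := by
  intro hle
  have hbot : maximalIdeal Λ = ⊥ := Submodule.eq_bot_of_le_smul_of_le_jacobson_bot
    (maximalIdeal Λ) _ (IsNoetherian.noetherian _) (by rwa [smul_eq_mul, ← pow_two])
    (maximalIdeal_le_jacobson _)
  have := h.le_height
  rw [hbot, Ideal.height_bot] at this
  simp at this

theorem HasRegularParameters.isDomain (h : HasRegularParameters Λ d) : IsDomain Λ := by
  induction d generalizing Λ with
  | zero =>
    obtain ⟨⟨s, hs⟩, -⟩ := h
    have : IsField Λ := isField_iff_maximalIdeal_eq.2 (by rw [← hs]; simp)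
    exact this.isDomain
  | succ d ih =>
    obtain ⟨x, hx, hx2⟩ : ∃ x ∈ maximalIdeal Λ, x ∉ maximalIdeal Λ ^ 2 ∧
        ∀ q ∈ minimalPrimes Λ, x ∉ q := by
      by_contra! hc
      have hfin := Ideal.finite_minimalPrimes_of_isNoetherianRing Λ ⊥
      have := (Ideal.subset_union_prime' (s := hfin.toFinset) (f := id)
        (a := maximalIdeal Λ ^ 2) (b := maximalIdeal Λ ^ 2) (I := maximalIdeal Λ)
        (fun q hq => (hfin.mem_toFinset.1 hq).1.1)).1 (by
          intro x hx
          by_cases hx2 : x ∈ maximalIdeal Λ ^ 2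
          · exact Or.inl (Or.inl hx2)
          · obtain ⟨q, hq, hxq⟩ := hc x hx hx2
            exact Or.inr (Set.mem_biUnion (hfin.mem_toFinset.2 hq) hxq))
      rcases this with h1 | h1 | ⟨q, hq, hle⟩
      · exact h.not_maximalIdeal_le_sq h1
      · exact h.not_maximalIdeal_le_sq h1
      · have hq' : q ∈ minimalPrimes Λ := hfin.mem_toFinset.1 hq
        have : q = maximalIdeal Λ := le_antisymm (le_maximalIdeal hq'.1.1.ne_top) hle
        exact h.maximalIdeal_notMem_minimalPrimes (this ▸ hq')
    have hloc := isLocalRing_quotient_span_singleton hx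
    have hdom := ih (h.quotient hx hx2.1)
    have hprime : (Ideal.span {x}).IsPrime := (Ideal.Quotient.isDomain_iff_prime _).1 hdom
    obtain ⟨q, hq, hqx⟩ := Ideal.exists_minimalPrimes_le (bot_le (a := Ideal.span {x}))
    have hqp : q.IsPrime := hq.1.1
    have hbot : q = ⊥ := Submodule.eq_bot_of_le_smul_of_le_jacobson_bot
      (maximalIdeal Λ) _ (IsNoetherian.noetherian _) (fun y hy => by
        obtain ⟨t, rfl⟩ := Ideal.mem_span_singleton.1 (hqx hy)
        exact Ideal.mul_mem_mul hx ((hqp.mem_or_mem hy).resolve_left (hx2.2 q hq)))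
      (maximalIdeal_le_jacobson _)
    subst hbot
    exact IsDomain.of_bot_isPrime Λ

lemma HasRegularParameters.prime (h : HasRegularParameters Λ (d + 1)) {x : Λ}
    (hx : x ∈ maximalIdeal Λ) (hx2 : x ∉ maximalIdeal Λ ^ 2) : Prime x := by
  have hloc := isLocalRing_quotient_span_singleton hx
  have hdom := (h.quotient hx hx2).isDomain
  exact (Ideal.span_singleton_prime (by rintro rfl; exact hx2 (zero_mem _))).1
    ((Ideal.Quotient.isDomain_iff_prime _).1 hdom)

/-- Principal ideals of a regular local ring are unmixed of height at most one. -/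
theorem HasRegularParameters.exists_height_le_one (h : HasRegularParameters Λ d) {a c : Λ}
    (ha : a ≠ 0) (hc : ¬ a ∣ c) {J : Ideal Λ} (hJ : ∀ y ∈ J, a ∣ y * c) :
    ∃ P : Ideal Λ, P.IsPrime ∧ J ≤ P ∧ P.height ≤ 1 := by
  induction d generalizing Λ with
  | zero =>
    obtain ⟨⟨s, hs⟩, -⟩ := h
    refine absurd (IsUnit.dvd ?_) hc
    by_contra hu
    have : a ∈ maximalIdeal Λ := hu
    rw [← hs] at this
    simp [ha] at this
  | succ d ih =>
    have hdom := h.isDomain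
    -- pass to an associated prime of `Λ ⧸ (a)`
    obtain ⟨P, hP, hJP, b, hb, hPb⟩ : ∃ P : Ideal Λ, P.IsPrime ∧ J ≤ P ∧
        ∃ c, ¬ a ∣ c ∧ ∀ y ∈ P, a ∣ y * c := by
      obtain ⟨P, hP, hle⟩ := exists_le_isAssociatedPrime_of_isNoetherianRing Λ
        (M := Λ ⧸ Ideal.span {a}) (Ideal.Quotient.mk _ c)
        (by rwa [Ne, Ideal.Quotient.eq_zero_iff_mem, Ideal.mem_span_singleton])
      obtain ⟨hprime, u, rfl⟩ := isAssociatedPrime_iff.1 hP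
      obtain ⟨c', rfl⟩ := Ideal.Quotient.mk_surjective u
      have key (r t : Λ) : r ∈ (⊥ : Submodule Λ (Λ ⧸ Ideal.span {a})).colon
          {Ideal.Quotient.mk _ t} ↔ a ∣ r * t := by
        rw [Submodule.mem_colon_singleton, Submodule.mem_bot, Algebra.smul_def,
          Ideal.Quotient.algebraMap_eq, ← map_mul, Ideal.Quotient.eq_zero_iff_mem,
          Ideal.mem_span_singleton]
      refine ⟨_, hprime, fun y hy => hle ((key y c).2 (hJ y hy)), c', fun hac => ?_,
        fun y hy => (key y c').1 hy⟩
      exact hprime.ne_top ((Ideal.eq_top_iff_one _).2 ((key 1 c').2 (by rwa [one_mul])))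
    refine ⟨P, hP, hJP, ?_⟩
    clear hc hJ c
    rename' b => c, hb => hc, hPb => hPc
    by_contra hht
    obtain ⟨x, hxm, hx2, hxP⟩ : ∃ x ∈ maximalIdeal Λ, x ∉ maximalIdeal Λ ^ 2 ∧
        (x ∈ P ∨ P ≤ maximalIdeal Λ ^ 2) := by
      by_cases hP2 : P ≤ maximalIdeal Λ ^ 2
      · obtain ⟨x, hx, hx2⟩ := SetLike.not_le_iff_exists.1 h.not_maximalIdeal_le_sq
        exact ⟨x, hx, hx2, .inr hP2⟩
      · obtain ⟨x, hx, hx2⟩ := SetLike.not_le_iff_exists.1 hP2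
        exact ⟨x, le_maximalIdeal hP.ne_top hx, hx2, .inl hx⟩
    have hx := h.prime hxm hx2
    have hPx : ¬ P ≤ Ideal.span {x} := fun hle => hht <|
      (Ideal.height_mono hle).trans (Ideal.height_span_singleton_le_one hx.not_isUnit)
    by_cases hxP' : x ∈ P
    · obtain ⟨v, hv⟩ := hPc x hxP'
      have hxav : x ∣ a * v := ⟨c, hv.symm⟩
      rcases hx.dvd_or_dvd hxav with ⟨a', rfl⟩ | ⟨v', rfl⟩
      · have hcv : c = a' * v := mul_left_cancel₀ hx.ne_zero (by rw [hv, mul_assoc])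
        refine hPx fun y hy => Ideal.mem_span_singleton.2 ?_
        obtain ⟨t, ht⟩ := hPc y hy
        have ha' : a' ≠ 0 := right_ne_zero_of_mul ha
        have : y * v = x * t := mul_left_cancel₀ ha' (by rw [hcv] at ht; linear_combination ht)
        refine (hx.dvd_or_dvd ⟨t, this⟩).resolve_right ?_
        rintro ⟨w, rfl⟩
        exact hc ⟨w, by rw [hcv]; ring⟩
      · exact hc ⟨v', mul_left_cancel₀ hx.ne_zero (by rw [hv]; ring)⟩
    -- divide `a` and `c` by `x` until `x` does not divide `a`
    obtain ⟨a, ha, hxa, c, hc, hPc⟩ : ∃ a : Λ, a ≠ 0 ∧ ¬ x ∣ a ∧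
        ∃ c, ¬ a ∣ c ∧ ∀ y ∈ P, a ∣ y * c := by
      obtain ⟨a', haa', hxa'⟩ :=
        (FiniteMultiplicity.of_prime_left hx ha).exists_eq_pow_mul_and_not_dvd
      generalize multiplicity x a = k at haa'
      subst haa'
      refine ⟨a', right_ne_zero_of_mul ha, hxa', ?_⟩
      clear ha ih
      induction k generalizing c with
      | zero => exact ⟨c, by simpa using hc, by simpa using hPc⟩
      | succ k ihk =>
        obtain ⟨y, hy, hyx⟩ := SetLike.not_le_iff_exists.1 hPx
        rw [Ideal.mem_span_singleton] at hyx
        obtain ⟨c', rfl⟩ : x ∣ c := (hx.dvd_or_dvd ((Dvd.intro (x ^ k * a') (by ring)).trans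
          (hPc y hy) : x ∣ y * c)).resolve_left hyx
        refine ihk c' (fun ⟨t, ht⟩ => hc ⟨t, by rw [ht]; ring⟩) fun z hz => ?_
        obtain ⟨t, ht⟩ := hPc z hz
        exact ⟨t, mul_left_cancel₀ hx.ne_zero (by linear_combination ht)⟩
    obtain ⟨c, hPc, hcx⟩ : ∃ c, (∀ y ∈ P, a ∣ y * c) ∧ c ∉ Ideal.span {a} ⊔ Ideal.span {x} := by
      by_contra! hall
      let C : Ideal Λ :=
        { carrier := {c | ∀ y ∈ P, a ∣ y * c}
          add_mem' := fun hu hv y hy => by rw [mul_add]; exact dvd_add (hu y hy) (hv y hy)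
          zero_mem' := fun y _ => by simp
          smul_mem' := fun r u hu y hy => by
            rw [smul_eq_mul, mul_left_comm]; exact (hu y hy).mul_left r }
      have hC : C ≤ Ideal.span {a} := by
        refine Submodule.le_of_le_smul_of_le_jacobson_bot (I := maximalIdeal Λ)
          (IsNoetherian.noetherian _) (maximalIdeal_le_jacobson _) fun u hu => ?_
        obtain ⟨v, hv, w, hw, rfl⟩ := Submodule.mem_sup.1 (hall u hu)
        refine Submodule.mem_sup.2 ⟨v, hv, w, ?_, rfl⟩
        obtain ⟨t, rfl⟩ := Ideal.mem_span_singleton.1 hw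
        obtain ⟨s, rfl⟩ := Ideal.mem_span_singleton.1 hv
        refine Ideal.mul_mem_mul hxm fun y hy => ?_
        obtain ⟨r, hr⟩ := hu y hy
        have h1 : x * (y * t) = a * (r - y * s) := by linear_combination hr
        obtain ⟨r', hr'⟩ := (hx.dvd_or_dvd ⟨_, h1.symm⟩).resolve_left hxa
        exact ⟨r', mul_left_cancel₀ hx.ne_zero (by rw [h1, hr']; ring)⟩
      exact hc (Ideal.mem_span_singleton.1 (hC hPc))
    have hloc := isLocalRing_quotient_span_singleton hxm
    obtain ⟨Q, hQ, hPQ, hQ1⟩ := ih (h.quotient hxm hx2) (a := Ideal.Quotient.mk _ a)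
      (c := Ideal.Quotient.mk _ c) (J := P.map (Ideal.Quotient.mk _))
      (by rwa [Ne, Ideal.Quotient.eq_zero_iff_mem, Ideal.mem_span_singleton])
      (by
        rintro ⟨t, ht⟩
        obtain ⟨t, rfl⟩ := Ideal.Quotient.mk_surjective t
        rw [← map_mul, Ideal.Quotient.eq] at ht
        refine hcx (Submodule.mem_sup.2 ⟨a * t, Ideal.mem_span_singleton.2 ⟨t, rfl⟩, _, ht, ?_⟩)
        ring)
      (fun y hy => by
        obtain ⟨z, hz, rfl⟩ :=
          (Ideal.mem_map_iff_of_surjective _ Ideal.Quotient.mk_surjective).1 hy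
        rw [← map_mul]
        exact map_dvd _ (hPc z hz))
    let P' := Q.comap (Ideal.Quotient.mk (Ideal.span {x}))
    have hxP'' : x ∈ P' := by simp [P', Ideal.mem_comap]
    have hlt : P < P' := lt_of_le_of_ne (Ideal.map_le_iff_le_comap.1 hPQ)
      fun h => hxP' (h ▸ hxP'')
    have h1 := Ideal.height_add_one_le_of_lt_of_isPrime hlt
    have h2 := Ideal.height_le_height_add_one_of_mem hxP''
    rw [Ideal.map_comap_of_surjective _ Ideal.Quotient.mk_surjective] at h2
    have h3 : P.height + 1 ≤ 1 + 1 := h1.trans (h2.trans (by gcongr))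
    exact hht ((ENat.add_le_add_iff_right ENat.one_ne_top).1 h3)

end IsLocalRing

namespace Module

open Matrix

variable {R : Type} [CommRing R] {N : Type} [AddCommGroup N] [Module R N]

/-- The ideal generated by the determinants of the square matrices of relations between the
generators `f`; it is the `0`-th Fitting ideal of the module they generate. -/
def relationIdeal {ι : Type} [Fintype ι] [DecidableEq ι] (f : ι → N) : Ideal R :=
  Ideal.span {d | ∃ C : Matrix ι ι R, (∀ i, ∑ j, C i j • f j = 0) ∧ d = C.det}

lemma relationIdeal_comp_equiv_le {ι κ : Type} [Fintype ι] [DecidableEq ι] [Fintype κ]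
    [DecidableEq κ] (f : κ → N) (e : ι ≃ κ) :
    relationIdeal (R := R) (f ∘ e) ≤ relationIdeal f := by
  refine Ideal.span_mono ?_
  rintro _ ⟨C, hC, rfl⟩
  refine ⟨C.submatrix e.symm e.symm, fun i => ?_, (Matrix.det_submatrix_equiv_self _ _).symm⟩
  rw [← hC (e.symm i), ← e.sum_comp]
  simp

lemma relationIdeal_comp_equiv {ι κ : Type} [Fintype ι] [DecidableEq ι] [Fintype κ]
    [DecidableEq κ] (f : κ → N) (e : ι ≃ κ) :
    relationIdeal (R := R) (f ∘ e) = relationIdeal f := by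
  refine le_antisymm (relationIdeal_comp_equiv_le f e) ?_
  simpa [Function.comp_assoc] using relationIdeal_comp_equiv_le (R := R) (f ∘ e) e.symm

lemma relationIdeal_cons {n : ℕ} (f : Fin n → N) {z : N} (w : Fin n → R)
    (hw : ∑ j, w j • f j = z) :
    relationIdeal (R := R) (Fin.cons z f : Fin (n + 1) → N) = relationIdeal f := by
  refine le_antisymm (Ideal.span_le.2 ?_) (Ideal.span_mono ?_)
  · rintro _ ⟨C, hC, rfl⟩
    let C' : Matrix (Fin (n + 1)) (Fin (n + 1)) R :=
      .of fun i j => C i j + (Fin.cons 0 w : Fin (n + 1) → R) j * C i 0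
    have hdet : C'.det = C.det := by
      rw [← Matrix.det_transpose C', ← Matrix.det_transpose C]
      exact Matrix.det_eq_of_forall_row_eq_smul_add_const (Fin.cons 0 w) 0 rfl
        (fun i j => rfl)
    rw [← hdet, Matrix.det_succ_column_zero]
    refine sum_mem fun i _ => Ideal.mul_mem_left _ _ (Ideal.subset_span ⟨_, fun k => ?_, rfl⟩)
    have := hC (i.succAbove k)
    rw [Fin.sum_univ_succ] at this
    simp only [Fin.cons_zero, Fin.cons_succ, ← hw, Finset.smul_sum] at this
    rw [← this, ← Finset.sum_add_distrib]
    refine Finset.sum_congr rfl fun j _ => ?_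
    have hC' : C' (i.succAbove k) j.succ =
        C (i.succAbove k) j.succ + w j * C (i.succAbove k) 0 := by simp [C']
    rw [Matrix.submatrix_apply, hC', add_smul, smul_smul, mul_comm (w j), add_comm]
  · rintro _ ⟨C, hC, rfl⟩
    refine ⟨Matrix.of (Fin.cons (Fin.cons 1 (-w)) fun i => Fin.cons 0 (C i)), fun i => ?_, ?_⟩
    · refine Fin.cases ?_ (fun i => ?_) i
      · simp [Fin.sum_univ_succ, hw]
      · simpa [Fin.sum_univ_succ] using hC i
    · rw [Matrix.det_succ_column_zero, Fin.sum_univ_succ]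
      have : (Matrix.of (Fin.cons (Fin.cons 1 (-w)) fun i => Fin.cons 0 (C i)) :
          Matrix (Fin (n + 1)) (Fin (n + 1)) R).submatrix Fin.succ Fin.succ = C := by
        ext i j
        simp
      simp [this]

lemma relationIdeal_append {n : ℕ} (f : Fin n → N) (hf : Submodule.span R (Set.range f) = ⊤)
    {k : ℕ} (g : Fin k → N) :
    relationIdeal (R := R) (Fin.append g f) = relationIdeal f := by
  induction k with
  | zero =>
    rw [Subsingleton.elim g Fin.elim0, Fin.elim0_append]
    exact relationIdeal_comp_equiv f (finCongr (Nat.zero_add n))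
  | succ k ih =>
    rw [← Fin.cons_self_tail g, Fin.append_cons]
    refine (relationIdeal_comp_equiv _ (finCongr (Nat.add_right_comm k 1 n))).trans ?_
    have hspan : g 0 ∈ Submodule.span R (Set.range (Fin.append (Fin.tail g) f)) := by
      refine Submodule.span_mono ?_ (hf.symm ▸ Submodule.mem_top : g 0 ∈ _)
      rintro _ ⟨i, rfl⟩
      exact ⟨Fin.natAdd k i, Fin.append_right _ _ _⟩
    obtain ⟨w, hw⟩ := (Submodule.mem_span_range_iff_exists_fun R).1 hspan
    rw [relationIdeal_cons _ w hw, ih]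

/-- The ideal of relations does not depend on the generators. -/
theorem relationIdeal_eq {n k : ℕ} (f : Fin n → N) (hf : Submodule.span R (Set.range f) = ⊤)
    (g : Fin k → N) (hg : Submodule.span R (Set.range g) = ⊤) :
    relationIdeal (R := R) f = relationIdeal g := by
  rw [← relationIdeal_append f hf g, ← relationIdeal_append g hg f,
    ← relationIdeal_comp_equiv (Fin.append f g) finAddFlip]
  congr 1
  ext i
  refine Fin.addCases (fun i => ?_) (fun i => ?_) i <;> simp

lemma sum_apply_single_smul {n : ℕ} (ψ : (Fin n → R) →ₗ[R] N) (x : Fin n → R) :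
    ∑ j, x j • ψ (Pi.single j 1) = ψ x := by
  conv_rhs => rw [pi_eq_sum_univ' x, map_sum]
  simp

theorem relationIdeal_eq_span_minors {n m : ℕ} (ψ : (Fin n → R) →ₗ[R] N)
    (A : Matrix (Fin n) (Fin m) R) (hA : LinearMap.ker ψ = LinearMap.range A.mulVecLin) :
    relationIdeal (R := R) (fun i => ψ (Pi.single i 1)) =
      Ideal.span {d | ∃ g : Fin n → Fin m, d = (A.submatrix id g).det} := by
  refine le_antisymm (Ideal.span_le.2 ?_) (Ideal.span_mono ?_)
  · rintro _ ⟨C, hC, rfl⟩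
    have h (i) : ∃ c, A.mulVecLin c = C i := by
      rw [← LinearMap.mem_range, ← hA, LinearMap.mem_ker, ← sum_apply_single_smul]
      exact hC i
    choose c hc using h
    have hC' : C = fun i => ∑ k, c i k • Aᵀ k := by
      ext i j
      rw [← hc]
      simp [Matrix.mulVec, dotProduct, mul_comm]
    have : C.det = ∑ g : Fin n → Fin m, (∏ i, c i (g i)) * (A.submatrix id g).det := by
      rw [hC']
      change Matrix.detRowAlternating.toMultilinearMap _ = _
      rw [MultilinearMap.map_sum]
      refine Finset.sum_congr rfl fun g _ => ?_
      rw [MultilinearMap.map_smul_univ, smul_eq_mul, ← Matrix.det_transpose (A.submatrix id g)]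
      rfl
    rw [SetLike.mem_coe, this]
    exact sum_mem fun g _ => Ideal.mul_mem_left _ _ (Ideal.subset_span ⟨g, rfl⟩)
  · rintro _ ⟨g, rfl⟩
    refine ⟨(A.submatrix id g)ᵀ, fun i => ?_, (Matrix.det_transpose _).symm⟩
    rw [sum_apply_single_smul ψ ((A.submatrix id g)ᵀ i), ← LinearMap.mem_ker, hA]
    exact ⟨Pi.single (g i) 1, by ext j; simp⟩

end Module

namespace Matrix

variable {R : Type} {r : ℕ} (X : Matrix (Fin r) (Fin (r + 1)) R)

/-- The square matrix with first row `a` and the remaining rows those of `X`. -/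
def consRow (a : Fin (r + 1) → R) : Matrix (Fin (r + 1)) (Fin (r + 1)) R :=
  of (Fin.cons a X)

@[simp] lemma consRow_zero (a : Fin (r + 1) → R) (j : Fin (r + 1)) : X.consRow a 0 j = a j := rfl

@[simp] lemma consRow_succ (a : Fin (r + 1) → R) (i : Fin r) (j : Fin (r + 1)) :
    X.consRow a i.succ j = X i j := rfl

variable [CommRing R]

/-- The signed maximal minors of an `r × (r + 1)` matrix. -/
def signedMinor (k : Fin (r + 1)) : R :=
  (-1) ^ (k : ℕ) * (X.submatrix id k.succAbove).det

lemma adjugate_consRow_apply_zero (a : Fin (r + 1) → R) (k : Fin (r + 1)) :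
    (X.consRow a).adjugate k 0 = X.signedMinor k := by
  rw [adjugate_fin_succ_eq_det_submatrix, signedMinor]
  simp only [Fin.val_zero, zero_add]
  congr 2

lemma det_consRow_single (k : Fin (r + 1)) :
    (X.consRow (Pi.single k 1)).det =
      X.signedMinor k := by
  rw [← adjugate_consRow_apply_zero X 0, adjugate_apply]
  congr 1
  ext i j
  refine Fin.cases ?_ (fun i => ?_) i <;> simp [updateRow_apply, Fin.succ_ne_zero]

lemma mulVec_signedMinor : X *ᵥ X.signedMinor = 0 := by
  ext i
  have h := congrFun₂ (mul_adjugate (X.consRow 0))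
    i.succ 0
  simpa [mulVec, dotProduct, mul_apply, adjugate_consRow_apply_zero, Fin.succ_ne_zero] using h

lemma signedMinor_mul_of_mulVec_eq_zero {x : Fin (r + 1) → R} (hx : X *ᵥ x = 0)
    (j k : Fin (r + 1)) : X.signedMinor k * x j = x k * X.signedMinor j := by
  set C := X.consRow (Pi.single k 1) with hC
  have h1 : C *ᵥ x = Pi.single 0 (x k) := by
    ext i
    refine Fin.cases ?_ (fun i => ?_) i
    · simp [hC, mulVec]
    · simpa [hC, mulVec] using congrFun hx i
  have h2 := congrArg (C.adjugate *ᵥ ·) h1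
  simp only [mulVec_mulVec, adjugate_mul, smul_mulVec, one_mulVec] at h2
  have h3 := congrFun h2 j
  rw [hC, det_consRow_single] at h3
  simpa [adjugate_consRow_apply_zero, mul_comm] using h3

lemma span_range_signedMinor :
    Ideal.span (Set.range X.signedMinor) =
      Ideal.span {d | ∃ g : Fin r → Fin (r + 1), d = (X.submatrix id g).det} := by
  refine le_antisymm (Ideal.span_le.2 ?_) (Ideal.span_le.2 ?_)
  · rintro _ ⟨k, rfl⟩
    exact Ideal.mul_mem_left _ _ (Ideal.subset_span ⟨_, rfl⟩)
  · rintro _ ⟨g, rfl⟩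
    obtain ⟨k, hk⟩ : ∃ k, ∀ i, g i ≠ k := by
      by_contra! h
      simpa using Fintype.card_le_of_surjective g h
    choose h hh using fun i => Fin.exists_succAbove_eq (hk i)
    have hg : X.submatrix id g =
        X.submatrix id k.succAbove * (1 : Matrix (Fin r) (Fin r) R).submatrix id h := by
      ext i j
      simp [mul_apply, ← hh, one_apply]
    have hu : (X.submatrix id k.succAbove).det = (-1) ^ (k : ℕ) * X.signedMinor k := by
      rw [signedMinor, ← mul_assoc, ← mul_pow]
      simp
    rw [SetLike.mem_coe, hg, det_mul, hu]
    exact Ideal.mul_mem_right _ _ (Ideal.mul_mem_left _ _ (Ideal.subset_span ⟨k, rfl⟩))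

end Matrix

namespace Matrix

variable {Λ R : Type} [CommRing Λ] [IsDomain Λ] [CommRing R] [Algebra Λ R] [Module.Free Λ R]
  {r : ℕ} (X : Matrix (Fin r) (Fin (r + 1)) R)

lemma toSpanSingleton_signedMinor_injective {a : Λ} (ha : a ≠ 0)
    (haI : algebraMap Λ R a ∈ Ideal.span (Set.range X.signedMinor)) :
    Function.Injective (LinearMap.toSpanSingleton R (Fin (r + 1) → R) X.signedMinor) := by
  refine (injective_iff_map_eq_zero _).2 fun w hw => ?_
  have h (t : R) (ht : t ∈ Ideal.span (Set.range X.signedMinor)) : w * t = 0 := by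
    induction ht using Submodule.span_induction with
    | mem t ht =>
      obtain ⟨k, rfl⟩ := ht
      exact congrFun hw k
    | zero => simp
    | add t t' _ _ h h' => rw [mul_add, h, h', add_zero]
    | smul c t _ h => rw [smul_eq_mul, mul_left_comm, h, mul_zero]
  have := h _ haI
  rw [mul_comm, ← Algebra.smul_def] at this
  exact (smul_eq_zero.1 this).resolve_left ha

variable [Module.Finite Λ R] [IsNoetherianRing Λ] [IsLocalRing Λ] {d : ℕ}

/-- A case of the Hilbert–Burch theorem. -/
theorem exact_toSpanSingleton_signedMinor (hΛ : IsLocalRing.HasRegularParameters Λ d) {a : Λ}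
    (ha : a ≠ 0) (haI : algebraMap Λ R a ∈ Ideal.span (Set.range X.signedMinor))
    (hI : ∀ P : Ideal Λ, P.IsPrime → P.height ≤ 1 →
      ¬ (Ideal.span (Set.range X.signedMinor)).comap (algebraMap Λ R) ≤ P) :
    Function.Exact (LinearMap.toSpanSingleton R (Fin (r + 1) → R) X.signedMinor)
      X.mulVecLin := by
  intro x
  refine ⟨fun hx => ?_, ?_⟩
  swap
  · rintro ⟨w, rfl⟩
    simp [mulVec_signedMinor]
  have hv (b : Λ) (hb : algebraMap Λ R b ∈ Ideal.span (Set.range X.signedMinor)) :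
      ∃ v : R, b • x = v • X.signedMinor := by
    obtain ⟨c, hc⟩ := Ideal.mem_span_range_iff_exists_fun.1 hb
    refine ⟨∑ k, c k * x k, ?_⟩
    ext j
    rw [Pi.smul_apply, Pi.smul_apply, Algebra.smul_def, smul_eq_mul, ← hc, Finset.sum_mul, Finset.sum_mul]
    refine Finset.sum_congr rfl fun k _ => ?_
    rw [mul_assoc, signedMinor_mul_of_mulVec_eq_zero X hx, mul_assoc]
  obtain ⟨u, hu⟩ := hv a haI
  have hinj := toSpanSingleton_signedMinor_injective X ha haI
  let β := Module.Free.chooseBasis Λ R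
  have hdvd (i) : a ∣ β.repr u i := by
    by_contra hn
    obtain ⟨P, hP, hle, hht⟩ := hΛ.exists_height_le_one ha hn
      (J := (Ideal.span (Set.range X.signedMinor)).comap (algebraMap Λ R)) fun b hb => by
        obtain ⟨v, hv⟩ := hv b hb
        have : a • v = b • u := hinj (by
          simp only [LinearMap.toSpanSingleton_apply, smul_assoc]
          rw [← hv, ← hu, smul_comm])
        exact ⟨β.repr v i, by simpa using congrArg (fun z => β.repr z i) this.symm⟩
    exact hI P hP hht hle
  obtain ⟨w, rfl⟩ : ∃ w, u = a • w := by
    choose c hc using hdvd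
    refine ⟨∑ i, c i • β i, ?_⟩
    simp_rw [Finset.smul_sum, smul_smul, ← hc]
    exact (β.sum_repr u).symm
  refine ⟨w, ?_⟩
  have : a • (w • X.signedMinor) = a • x := by rw [hu, smul_assoc]
  exact smul_right_injective _ ha this

end Matrix

namespace Module

open TensorProduct

variable {R : Type} [CommRing R]

lemma finrank_quotient_tensorProduct_eq_rankAtStalk {K : Type} [AddCommGroup K] [Module R K]
    [Module.Finite R K] [Module.Flat R K] (P : Ideal R) [hP : P.IsMaximal] :
    finrank (R ⧸ P) ((R ⧸ P) ⊗[R] K) = rankAtStalk K ⟨P, hP.isPrime⟩ := by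
  let := Ideal.Quotient.field P
  have h := rankAtStalk_baseChange (R := R) (M := K) (S := R ⧸ P) ⟨⊥, Ideal.isPrime_bot⟩
  rw [rankAtStalk_eq_finrank_of_free] at h
  have hc : PrimeSpectrum.comap (algebraMap R (R ⧸ P)) ⟨⊥, Ideal.isPrime_bot⟩ =
      ⟨P, hP.isPrime⟩ := by
    ext x
    simp [PrimeSpectrum.comap, Ideal.mem_comap, Ideal.Quotient.eq_zero_iff_mem]
  rw [hc] at h
  exact h

lemma rankAtStalk_add_of_localizedModule_equiv {K F M : Type} [AddCommGroup K] [Module R K]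
    [AddCommGroup F] [Module R F] [AddCommGroup M] [Module R M]
    [Module.Finite R K] [Module.Flat R K] [Module.Finite R F] [Module.Free R F]
    (S : Submonoid R) (e : LocalizedModule S M ≃ₗ[Localization S] Localization S)
    (f : K →ₗ[R] F) (g : F →ₗ[R] M) (hf : Function.Injective f) (hfg : Function.Exact f g)
    (hg : Function.Surjective g) (p : PrimeSpectrum (Localization S)) :
    rankAtStalk K (p.comap (algebraMap R _)) + 1 = finrank R F := by
  let f' := LocalizedModule.map S f
  let g' := e.toLinearMap ∘ₗ LocalizedModule.map S g
  have hf' : Function.Injective f' := LocalizedModule.map_injective S f hf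
  have hg' : Function.Surjective g' := e.surjective.comp (LocalizedModule.map_surjective S g hg)
  have hfg' : Function.Exact f' g' := fun x => by
    rw [LinearMap.comp_apply, LinearEquiv.coe_coe, map_eq_zero_iff _ e.injective]
    exact LocalizedModule.map_exact S f g hfg x
  obtain ⟨l, hl⟩ := Module.projective_lifting_property g' .id hg'
  let E := (hfg'.splitSurjectiveEquiv hf' ⟨l, hl⟩).1
  have hK := LocalizedModule.isBaseChange S K
  have hF := LocalizedModule.isBaseChange S F
  have : Module.Flat (Localization S) (LocalizedModule S K) := inferInstance
  have : Module.Finite (Localization S) (LocalizedModule S K) := inferInstance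
  have : Nontrivial (Localization S) := ⟨0, 1, fun h => p.2.ne_top
    ((Ideal.eq_top_iff_one _).2 (h ▸ zero_mem _))⟩
  have : Nontrivial R := (algebraMap R (Localization S)).domain_nontrivial
  have h1 := congrFun (rankAtStalk_eq_of_equiv E) p
  rw [rankAtStalk_prod, rankAtStalk_self, rankAtStalk_isBaseChange hF, rankAtStalk_eq_finrank_of_free,
    Pi.add_apply, rankAtStalk_isBaseChange hK] at h1
  exact h1.symm

theorem nonempty_basis_of_generic_rank_one [Nontrivial R] [Finite (MaximalSpectrum R)]
    {K F M : Type} [AddCommGroup K] [Module R K]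
    [AddCommGroup F] [Module R F] [AddCommGroup M] [Module R M]
    [Module.Finite R K] [Module.Flat R K] [Module.Finite R F] [Module.Free R F]
    (e : LocalizedModule (nonZeroDivisors R) M ≃ₗ[Localization (nonZeroDivisors R)]
      Localization (nonZeroDivisors R))
    (f : K →ₗ[R] F) (g : F →ₗ[R] M) (hf : Function.Injective f) (hfg : Function.Exact f g)
    (hg : Function.Surjective g) :
    ∃ r, finrank R F = r + 1 ∧ Nonempty (Basis (Fin r) R K) := by
  have key (P : Ideal R) [hP : P.IsPrime] : rankAtStalk K ⟨P, hP⟩ + 1 = finrank R F := by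
    obtain ⟨q, hq, hqP⟩ := Ideal.exists_minimalPrimes_le (bot_le (a := P))
    have hqp : q.IsPrime := hq.1.1
    have hdisj : Disjoint (nonZeroDivisors R : Set R) q :=
      (Ideal.disjoint_nonZeroDivisors_of_mem_minimalPrimes hq).symm
    have : (⟨q, hqp⟩ : PrimeSpectrum R) ∈ Set.range (PrimeSpectrum.comap
        (algebraMap R (Localization (nonZeroDivisors R)))) := by
      rw [PrimeSpectrum.localization_comap_range _ (nonZeroDivisors R)]
      exact hdisj
    obtain ⟨p, hp⟩ := this
    rw [← rankAtStalk_eq_of_le_of_finite_of_flat' K hqP, ← hp]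
    exact rankAtStalk_add_of_localizedModule_equiv _ e f g hf hfg hg p
  obtain ⟨P, hP⟩ := Ideal.exists_maximal R
  refine ⟨rankAtStalk K ⟨P, hP.isPrime⟩, (key P).symm, nonempty_basis_of_flat_of_finrank_eq _ _ _
    fun P' => ?_⟩
  have := P'.2
  rw [finrank_quotient_tensorProduct_eq_rankAtStalk]
  exact Nat.succ_injective ((key _).trans (key P).symm)

end Module

lemma MaximalSpectrum.finite_of_finite_of_isLocalRing (Λ R : Type) [CommRing Λ] [IsLocalRing Λ]
    [CommRing R] [Algebra Λ R] [Module.Finite Λ R] : Finite (MaximalSpectrum R) := by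
  have h := Algebra.QuasiFinite.finite_primesOver (S := R) (IsLocalRing.maximalIdeal Λ)
  have := h.to_subtype
  refine Finite.of_injective (β := (IsLocalRing.maximalIdeal Λ).primesOver R)
    (fun P => ⟨P.1, P.2.isPrime, ⟨?_⟩⟩) fun P Q h => MaximalSpectrum.ext (congrArg Subtype.val h)
  have := P.2
  exact (IsLocalRing.eq_maximalIdeal
    (Ideal.isMaximal_comap_of_isIntegral_of_isMaximal (R := Λ) P.1)).symm

lemma IsRegularLocal.exists_hasRegularParameters {Λ : Type} [CommRing Λ] [IsLocalRing Λ]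
    (h : IsRegularLocal Λ) : ∃ d, IsLocalRing.HasRegularParameters Λ d := by
  obtain ⟨s, hs, hd⟩ := h
  refine ⟨s.card, ⟨fun i => s.equivFin.symm i, ?_⟩, ?_⟩
  · rw [← hs]
    congr 1
    ext x
    exact ⟨fun ⟨i, hi⟩ => hi ▸ (s.equivFin.symm i).2, fun hx => ⟨s.equivFin ⟨x, hx⟩, by simp⟩⟩
  · rw [← WithBot.coe_le_coe, IsLocalRing.maximalIdeal_height_eq_ringKrullDim, ← hd]
    rfl

lemma heightLEOne_of_height_le_one {Λ : Type} [CommRing Λ] {P : Ideal Λ} [P.IsPrime]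
    (h : P.height ≤ 1) : HeightLEOne Λ P := by
  rintro ⟨q₀, q₁, h₀, h₁, h₀₁, h₁P⟩
  have h2 := (add_le_add_left (Ideal.height_add_one_le_of_lt_of_isPrime h₀₁) 1).trans
    ((Ideal.height_add_one_le_of_lt_of_isPrime h₁P).trans h)
  have h3 : q₀.height + 1 ≤ 0 := by
    rwa [← ENat.add_le_add_iff_right ENat.one_ne_top, zero_add]
  simp at h3

lemma IsPseudoNull.not_comap_relationIdeal_le {Λ R : Type} [CommRing Λ] [CommRing R] [Algebra Λ R]
    {N : Type} [AddCommGroup N] [Module R N] (hN : IsPseudoNull Λ (𝓡 := R) N) {n : ℕ}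
    (f : Fin n → N) {P : Ideal Λ} (hP : P.IsPrime) (hht : P.height ≤ 1) :
    ¬ (Module.relationIdeal (R := R) f).comap (algebraMap Λ R) ≤ P := by
  choose s hsP hs using fun i => hN P hP (heightLEOne_of_height_le_one hht) (f i)
  have hmem : algebraMap Λ R (∏ i, s i) ∈ Module.relationIdeal (R := R) f := by
    refine Ideal.subset_span ⟨Matrix.diagonal fun i => algebraMap Λ R (s i), fun i => ?_, ?_⟩
    · rw [Finset.sum_eq_single i, Matrix.diagonal_apply_eq, hs]
      · intro j _ hj
        rw [Matrix.diagonal_apply_ne _ hj.symm, zero_smul]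
      · simp
    · rw [Matrix.det_diagonal, map_prod]
  intro hle
  obtain ⟨i, -, hi⟩ := (hP.prod_mem_iff).1 (hle (show _ ∈ _ from hmem))
  exact hsP i hi

section Presentation

variable {R : Type} [CommRing R]

lemma ker_comp_piRing_symm {r n : ℕ} {N : Type} [AddCommGroup N] [Module R N]
    (d : (Fin r → R) →ₗ[R] (Fin n → R)) (q : ((Fin r → R) →ₗ[R] R) →ₗ[R] N)
    (hq : LinearMap.ker q = LinearMap.range (d.lcomp R R)) :
    LinearMap.ker (q ∘ₗ (LinearEquiv.piRing R R (Fin r) R).symm.toLinearMap) =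
      LinearMap.range (Matrix.of fun i => d (Pi.single i 1)).mulVecLin := by
  have key (l : (Fin n → R) →ₗ[R] R) : LinearEquiv.piRing R R (Fin r) R (d.lcomp R R l) =
      (Matrix.of fun i => d (Pi.single i 1)).mulVecLin (LinearEquiv.piRing R R (Fin n) R l) := by
    ext i
    exact (Module.sum_apply_single_smul l _).symm
  ext y
  rw [LinearMap.mem_ker, LinearMap.comp_apply, ← LinearMap.mem_ker, hq]
  constructor
  · rintro ⟨l, hl⟩
    exact ⟨_, by rw [← key, hl]; simp⟩
  · rintro ⟨c, rfl⟩
    obtain ⟨l, rfl⟩ := (LinearEquiv.piRing R R (Fin n) R).surjective c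
    exact ⟨l, by rw [← key]; simp⟩

lemma ker_comp_ringLmapEquivSelf_symm {n : ℕ} {N : Type} [AddCommGroup N] [Module R N]
    (D : Fin n → R) (q : (R →ₗ[R] R) →ₗ[R] N)
    (hq : LinearMap.ker q =
      LinearMap.range ((LinearMap.toSpanSingleton R (Fin n → R) D).lcomp R R)) :
    LinearMap.ker (q ∘ₗ (LinearMap.ringLmapEquivSelf R R R).symm.toLinearMap) =
      Ideal.span (Set.range D) := by
  ext y
  rw [LinearMap.mem_ker, LinearMap.comp_apply, ← LinearMap.mem_ker, hq,
    Ideal.mem_span_range_iff_exists_fun]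
  constructor
  · rintro ⟨l, hl⟩
    refine ⟨fun k => l (Pi.single k 1), ?_⟩
    have := LinearMap.congr_fun hl 1
    simp only [LinearMap.lcomp_apply, LinearMap.toSpanSingleton_apply, one_smul] at this
    rw [← Module.sum_apply_single_smul] at this
    simpa [mul_comm] using this
  · rintro ⟨c, rfl⟩
    refine ⟨(LinearEquiv.piRing R R (Fin n) R).symm c, ?_⟩
    ext
    rw [LinearMap.lcomp_apply, ← Module.sum_apply_single_smul]
    simp [Pi.single_apply, mul_comm]

end Presentation

/-- `Ext²(N, R)` for a torsion module `N` presented by an `r × (r + 1)` matrix. -/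
theorem nonempty_quotient_relationIdeal_equiv_ext_two {Λ R : Type} [CommRing Λ]
    [IsNoetherianRing Λ] [IsLocalRing Λ] (hreg : IsRegularLocal Λ) [CommRing R] [Algebra Λ R]
    [Module.Free Λ R] [Module.Finite Λ R] {N : Type} [AddCommGroup N] [Module R N]
    (hPN : IsPseudoNull Λ (𝓡 := R) N) {r : ℕ} (X : Matrix (Fin r) (Fin (r + 1)) R)
    (ψ : (Fin r → R) →ₗ[R] N) (hψ : Function.Surjective ψ)
    (hX : LinearMap.ker ψ = LinearMap.range X.mulVecLin) :
    Nonempty ((R ⧸ Module.relationIdeal (R := R) fun i => ψ (Pi.single i 1)) ≃ₗ[R]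
      ↥(ExtGrp R N 2)) := by
  obtain ⟨d, hΛ⟩ := hreg.exists_hasRegularParameters
  have := hΛ.isDomain
  have hspan := (Module.relationIdeal_eq_span_minors ψ X hX).trans X.span_range_signedMinor.symm
  have hI (P : Ideal Λ) (hP : P.IsPrime) (hht : P.height ≤ 1) :
      ¬ (Ideal.span (Set.range X.signedMinor)).comap (algebraMap Λ R) ≤ P :=
    hspan ▸ hPN.not_comap_relationIdeal_le _ hP hht
  obtain ⟨a, haI, ha⟩ := SetLike.not_le_iff_exists.1 (hI ⊥ Ideal.isPrime_bot (by simp))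
  obtain ⟨q, hq, hker⟩ := exists_surjective_ext_two
    (LinearMap.toSpanSingleton R (Fin (r + 1) → R) X.signedMinor) X.mulVecLin ψ
    (X.toSpanSingleton_signedMinor_injective ha haI)
    (X.exact_toSpanSingleton_signedMinor hΛ ha haI hI) (LinearMap.exact_iff.2 hX) hψ
  exact ⟨(Submodule.quotEquivOfEq _ _
    (hspan.trans (ker_comp_ringLmapEquivSelf_symm _ q hker).symm)).trans
      (LinearMap.quotKerEquivOfSurjective _
        (hq.comp (LinearMap.ringLmapEquivSelf R R R).symm.surjective))⟩

/-- Let `Λ` be a commutative Noetherian regular local ring and `𝓡` a commutative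
`Λ`-algebra, free of finite rank as a `Λ`-module, with `Hom_Λ(𝓡, Λ) ≅ 𝓡` as
`𝓡`-modules.  Let `M` be a finitely generated `𝓡`-module with `pd_𝓡(M) ≤ 1` such that
`N = Ext¹_𝓡(M, 𝓡)` is pseudo-null and `M` has generic rank one over `𝓡`.  Then for any
finite presentation `𝓡^m → 𝓡^n → N → 0` with first map given by the matrix `A`, letting
`I` be the ideal generated by the `n × n` minors of `A` (the 0-th Fitting ideal of `N`),
there is an isomorphism of `𝓡`-modules `𝓡/I ≅ Ext²_𝓡(N, 𝓡)`. -/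
theorem quotient_fittingIdeal_iso_ext_ext
    (Λ 𝓡 : Type) [CommRing Λ] [IsNoetherianRing Λ] [IsLocalRing Λ]
    (hreg : IsRegularLocal Λ)
    [CommRing 𝓡] [Algebra Λ 𝓡] [Module.Free Λ 𝓡] [Module.Finite Λ 𝓡]
    (hdual : SelfDualAlgebra Λ 𝓡)
    (M : Type) [AddCommGroup M] [Module 𝓡 M] [Module.Finite 𝓡 M]
    (hpd : ProjDimLEOne 𝓡 M)
    (hPN : IsPseudoNull Λ (𝓡 := 𝓡) ↥(ExtGrp 𝓡 M 1))
    (hrk : GenericRankOne 𝓡 M)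
    (n m : ℕ) (A : Matrix (Fin n) (Fin m) 𝓡)
    (ψ : (Fin n → 𝓡) →ₗ[𝓡] ↥(ExtGrp 𝓡 M 1))
    (hψ : Function.Surjective ψ)
    (hexact : LinearMap.ker ψ = LinearMap.range A.mulVecLin)
    (I : Ideal 𝓡)
    (hI : I = Ideal.span {d : 𝓡 | ∃ g : Fin n → Fin m, d = (A.submatrix id g).det}) :
    Nonempty ((𝓡 ⧸ I) ≃ₗ[𝓡] ↥(ExtGrp 𝓡 (↥(ExtGrp 𝓡 M 1)) 2)) := by
  obtain hR | hR := subsingleton_or_nontrivial 𝓡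
  · have := Module.subsingleton 𝓡 ↥(ExtGrp 𝓡 (↥(ExtGrp 𝓡 M 1)) 2)
    have := Module.subsingleton 𝓡 (𝓡 ⧸ I)
    exact ⟨0⟩
  have hNoeth : IsNoetherianRing 𝓡 := IsNoetherianRing.of_finite Λ 𝓡
  have := MaximalSpectrum.finite_of_finite_of_isLocalRing Λ 𝓡
  obtain ⟨n₀, φ, hφ, hproj⟩ := hpd
  obtain ⟨e⟩ := hrk
  obtain ⟨r, hr, ⟨b⟩⟩ := Module.nonempty_basis_of_generic_rank_one e (LinearMap.ker φ).subtype φ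
    (Submodule.injective_subtype _) (LinearMap.exact_subtype_ker_map φ) hφ
  obtain rfl : n₀ = r + 1 := by simpa using hr
  let d : (Fin r → 𝓡) →ₗ[𝓡] (Fin (r + 1) → 𝓡) :=
    (LinearMap.ker φ).subtype ∘ₗ b.equivFun.symm.toLinearMap
  obtain ⟨q, hq, hker⟩ := exists_surjective_ext_one d φ
    ((Submodule.injective_subtype _).comp b.equivFun.symm.injective)
    (LinearMap.exact_iff.2 (by
      rw [LinearMap.range_comp, LinearEquiv.range, Submodule.map_top, Submodule.range_subtype])) hφ
  have hspan {k : ℕ} (χ : (Fin k → 𝓡) →ₗ[𝓡] ↥(ExtGrp 𝓡 M 1)) (hχ : Function.Surjective χ) :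
      Submodule.span 𝓡 (Set.range fun i => χ (Pi.single i 1)) = ⊤ := by
    refine eq_top_iff.2 fun z _ => ?_
    obtain ⟨x, rfl⟩ := hχ z
    exact (Submodule.mem_span_range_iff_exists_fun 𝓡).2 ⟨x, Module.sum_apply_single_smul χ x⟩
  let ψ' := q ∘ₗ (LinearEquiv.piRing 𝓡 𝓡 (Fin r) 𝓡).symm.toLinearMap
  have hψ' : Function.Surjective ψ' := hq.comp (LinearEquiv.surjective _)
  rw [hI, ← Module.relationIdeal_eq_span_minors ψ A hexact,
    Module.relationIdeal_eq _ (hspan ψ hψ) _ (hspan ψ' hψ')]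
  exact nonempty_quotient_relationIdeal_equiv_ext_two hreg hPN _ ψ' hψ'
    (ker_comp_piRing_symm d q hker)
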